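/- Let d ≥ 0 be an integer and Γ ∈ ℂ^{(2d+1)×(2d+1)} (indices 0,…,2d). Define the bivariate trigonometric polynomial γ(w₁,w₂) = Σ_{k₁=0}^{2d} Σ_{k₂=0}^{2d} Γ_{k₁,k₂} e^{i w₁(k₁−d)} e^{i w₂(k₂−d)}. Let n ≥ 2d+1, let Ω_n = {2πl/n : l ∈ {1,…,n}}, and set α = 2d/n. Then max_{(w₁,w₂)∈[0,2π]²} |γ(w₁,w₂)| ≤ (1−α)^{-1} · max_{(w₁′,w₂′)∈Ω_n×Ω_n} |γ(w₁′,w₂′)|. -/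

import Mathlib

open Matrix

/-- Orthogonality of the sampled characters. -/
lemma aux_orth (n : ℕ) (ω : ℂ) (hω : IsPrimitiveRoot ω n) (i j : ℕ) (hi : i < n) (hj : j < n) :
    ∑ l : Fin n, (ω ^ ((l : ℕ) + 1)) ^ i * ((ω ^ ((l : ℕ) + 1))⁻¹) ^ j
      = if i = j then (n : ℂ) else 0 := by
  have hω0 : ω ≠ 0 := hω.ne_zero (by omega)
  have hterm : ∀ l : ℕ, (ω ^ (l + 1)) ^ i * ((ω ^ (l + 1))⁻¹) ^ j
      = (ω ^ i * (ω⁻¹) ^ j) * (ω ^ i * (ω⁻¹) ^ j) ^ l := by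
    intro l
    rw [← pow_succ', mul_pow, ← inv_pow, ← pow_mul, ← pow_mul, ← pow_mul, ← pow_mul,
      mul_comm i, mul_comm j]
  simp only [hterm]
  rw [← Finset.mul_sum, Fin.sum_univ_eq_sum_range (fun l => (ω ^ i * (ω⁻¹) ^ j) ^ l) n]
  split_ifs with h
  · subst h
    have : ω ^ i * (ω⁻¹) ^ i = 1 := by
      rw [← mul_pow, mul_inv_cancel₀ hω0, one_pow]
    rw [this]; simp
  · have hx : ω ^ i * (ω⁻¹) ^ j ≠ 1 := by
      intro hx
      apply h
      apply hω.pow_inj hi hj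
      rw [inv_pow] at hx
      exact (mul_inv_eq_one₀ (pow_ne_zero _ hω0)).1 hx
    have hn1 : (ω ^ i * (ω⁻¹) ^ j) ^ n = 1 := by
      rw [mul_pow, ← pow_mul, ← pow_mul, mul_comm i, mul_comm j, pow_mul, pow_mul, inv_pow,
        hω.pow_eq_one]
      simp
    rw [geom_sum_eq hx, hn1]
    simp

lemma aux_interp (n : ℕ) (ω : ℂ) (hω : IsPrimitiveRoot ω n) (z : ℂ) (k : ℕ) (hk : k < n) :
    ∑ l : Fin n, (ω ^ ((l : ℕ) + 1)) ^ k *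
      ∑ j ∈ Finset.range n, (z * (ω ^ ((l : ℕ) + 1))⁻¹) ^ j = n * z ^ k := by
  have h1 : ∀ l : Fin n, (ω ^ ((l : ℕ) + 1)) ^ k *
      ∑ j ∈ Finset.range n, (z * (ω ^ ((l : ℕ) + 1))⁻¹) ^ j
      = ∑ j ∈ Finset.range n, z ^ j *
        ((ω ^ ((l : ℕ) + 1)) ^ k * ((ω ^ ((l : ℕ) + 1))⁻¹) ^ j) := by
    intro l
    rw [Finset.mul_sum]
    refine Finset.sum_congr rfl fun j _ => ?_
    rw [mul_pow]; ring
  simp only [h1]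
  rw [Finset.sum_comm]
  simp only [← Finset.mul_sum]
  rw [Finset.sum_congr rfl fun j hj => by
    rw [aux_orth n ω hω k j hk (Finset.mem_range.1 hj)]]
  simp [hk]
  ring

lemma aux_parseval (n : ℕ) (ω : ℂ) (hω : IsPrimitiveRoot ω n) (hωn : ‖ω‖ = 1)
    (z : ℂ) (hz : ‖z‖ = 1) (b : ℕ) (hb : b ≤ n) :
    ∑ l : Fin n, ‖∑ j ∈ Finset.range b, (z * (ω ^ ((l : ℕ) + 1))⁻¹) ^ j‖ ^ 2
      = (n : ℝ) * b := by
  have hz0 : z ≠ 0 := by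
    intro h; simp [h] at hz
  have hterm : ∀ l : Fin n,
      (((‖∑ j ∈ Finset.range b, (z * (ω ^ ((l : ℕ) + 1))⁻¹) ^ j‖ ^ 2 : ℝ)) : ℂ)
      = ∑ i ∈ Finset.range b, ∑ j ∈ Finset.range b, (z⁻¹) ^ i * z ^ j *
        ((ω ^ ((l : ℕ) + 1)) ^ i * ((ω ^ ((l : ℕ) + 1))⁻¹) ^ j) := by
    intro l
    have hu : ‖z * (ω ^ ((l : ℕ) + 1))⁻¹‖ = 1 := by simp [hz, hωn]
    have hc : (starRingEnd ℂ) (z * (ω ^ ((l : ℕ) + 1))⁻¹) = z⁻¹ * ω ^ ((l : ℕ) + 1) := by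
      rw [← Complex.inv_eq_conj hu, mul_inv, inv_inv]
    push_cast
    rw [← Complex.conj_mul', map_sum, Finset.sum_mul_sum]
    refine Finset.sum_congr rfl fun i _ => Finset.sum_congr rfl fun j _ => ?_
    rw [map_pow, hc, mul_pow, mul_pow]
    ring
  have : ((∑ l : Fin n, ‖∑ j ∈ Finset.range b, (z * (ω ^ ((l : ℕ) + 1))⁻¹) ^ j‖ ^ 2 : ℝ) : ℂ)
      = ((n : ℝ) * b : ℝ) := by
    rw [Complex.ofReal_sum]
    simp only [hterm]
    rw [Finset.sum_comm]
    have h2 : ∀ i ∈ Finset.range b, ∑ l : Fin n, ∑ j ∈ Finset.range b, (z⁻¹) ^ i * z ^ j *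
        ((ω ^ ((l : ℕ) + 1)) ^ i * ((ω ^ ((l : ℕ) + 1))⁻¹) ^ j) = n := by
      intro i hi
      rw [Finset.sum_comm]
      simp only [← Finset.mul_sum]
      have hi' := Finset.mem_range.1 hi
      rw [Finset.sum_congr rfl fun j hj => by
        rw [aux_orth n ω hω i j (by omega) (by have := Finset.mem_range.1 hj; omega)]]
      have h1 : z⁻¹ ^ i * z ^ i = 1 := by
        rw [← mul_pow, inv_mul_cancel₀ hz0, one_pow]
      simp only [mul_ite, mul_zero, Finset.sum_ite_eq, if_pos hi, h1, one_mul]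
    rw [Finset.sum_congr rfl h2]
    simp
    ring
  exact_mod_cast this

lemma aux_core (d n : ℕ) (hn : 2 * d + 1 ≤ n) (ω : ℂ) (hω : IsPrimitiveRoot ω n)
    (hωn : ‖ω‖ = 1) (z : ℂ) (hz : ‖z‖ = 1) (c : Fin (2 * d + 1) → ℂ) (M : ℝ)
    (h : ∀ l : Fin n, ‖∑ k, c k * (ω ^ ((l : ℕ) + 1)) ^ (k : ℕ)‖ ≤ M) :
    ‖∑ k, c k * z ^ (k : ℕ)‖ ≤ Real.sqrt ((n : ℝ) / (n - 2 * d)) * M := by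
  obtain ⟨a, ha⟩ : ∃ a, n = a + 2 * d := ⟨n - 2 * d, by omega⟩
  have hapos : 0 < a := by omega
  have hnpos : 0 < n := by omega
  have hM : 0 ≤ M := (norm_nonneg _).trans (h ⟨0, hnpos⟩)
  have hz0 : z ≠ 0 := by
    intro h; simp [h] at hz
  have hω0 : ω ≠ 0 := hω.ne_zero (by omega)
  set A : Fin n → ℂ := fun l => ∑ i ∈ Finset.range a, (z * (ω ^ ((l : ℕ) + 1))⁻¹) ^ i with hA
  set B : Fin n → ℂ := fun l => ∑ i ∈ Finset.range n, (z * (ω ^ ((l : ℕ) + 1))⁻¹) ^ i with hB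
  have hAn : ∀ l, (starRingEnd ℂ) (A l)
      = ∑ i ∈ Finset.range a, z⁻¹ ^ i * (ω ^ ((l : ℕ) + 1)) ^ i := by
    intro l
    have hu : ‖z * (ω ^ ((l : ℕ) + 1))⁻¹‖ = 1 := by simp [hz, hωn]
    have hc : (starRingEnd ℂ) (z * (ω ^ ((l : ℕ) + 1))⁻¹) = z⁻¹ * ω ^ ((l : ℕ) + 1) := by
      rw [← Complex.inv_eq_conj hu, mul_inv, inv_inv]
    rw [hA]
    simp only [map_sum]
    exact Finset.sum_congr rfl fun i _ => by rw [map_pow, hc, mul_pow]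
  have key : ∑ l : Fin n, (∑ k, c k * (ω ^ ((l : ℕ) + 1)) ^ (k : ℕ)) *
      ((starRingEnd ℂ) (A l) * B l) = (n : ℂ) * a * ∑ k, c k * z ^ (k : ℕ) := by
    have e1 : ∀ l : Fin n, (∑ k, c k * (ω ^ ((l : ℕ) + 1)) ^ (k : ℕ)) *
      ((starRingEnd ℂ) (A l) * B l) = ∑ k, ∑ i ∈ Finset.range a, (c k * z⁻¹ ^ i) *
        ((ω ^ ((l : ℕ) + 1)) ^ ((k : ℕ) + i) * B l) := by
      intro l
      rw [hAn, ← mul_assoc, Finset.sum_mul_sum, Finset.sum_mul]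
      refine Finset.sum_congr rfl fun k _ => ?_
      rw [Finset.sum_mul]
      refine Finset.sum_congr rfl fun i _ => ?_
      rw [pow_add]; ring
    simp only [e1]
    rw [Finset.sum_comm, Finset.mul_sum]
    refine Finset.sum_congr rfl fun k _ => ?_
    rw [Finset.sum_comm]
    have e2 : ∀ i ∈ Finset.range a, ∑ l : Fin n, (c k * z⁻¹ ^ i) *
        ((ω ^ ((l : ℕ) + 1)) ^ ((k : ℕ) + i) * B l) = n * (c k * z ^ (k : ℕ)) := by
      intro i hi
      have hi' := Finset.mem_range.1 hi
      have hk := k.2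
      rw [← Finset.mul_sum, hB, aux_interp n ω hω z ((k : ℕ) + i) (by omega), pow_add]
      have h1 : z⁻¹ ^ i * z ^ i = 1 := by
        rw [← mul_pow, inv_mul_cancel₀ hz0, one_pow]
      linear_combination (n * c k * z ^ (k : ℕ)) * h1
    rw [Finset.sum_congr rfl e2]
    simp
    ring
  have hle : (n : ℝ) * a * ‖∑ k, c k * z ^ (k : ℕ)‖ ≤ M * ∑ l : Fin n, ‖A l‖ * ‖B l‖ := by
    have : (n : ℝ) * a * ‖∑ k, c k * z ^ (k : ℕ)‖
        = ‖(n : ℂ) * a * ∑ k, c k * z ^ (k : ℕ)‖ := by simp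
    rw [this, ← key, Finset.mul_sum]
    refine (norm_sum_le _ _).trans (Finset.sum_le_sum fun l _ => ?_)
    rw [norm_mul, norm_mul, RCLike.norm_conj]
    exact mul_le_mul_of_nonneg_right (h l) (by positivity)
  have hcs : ∑ l : Fin n, ‖A l‖ * ‖B l‖ ≤ Real.sqrt (n * a) * Real.sqrt (n * n) := by
    have := Real.sum_mul_le_sqrt_mul_sqrt Finset.univ (fun l => ‖A l‖) (fun l => ‖B l‖)
    rwa [aux_parseval n ω hω hωn z hz a (by omega), aux_parseval n ω hω hωn z hz n le_rfl] at this
  have hsub : (n : ℝ) - 2 * d = a := by rw [ha]; push_cast; ring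
  have haR : (0 : ℝ) < a := by exact_mod_cast hapos
  have hnR : (0 : ℝ) < n := by exact_mod_cast hnpos
  have hs : Real.sqrt ((n : ℝ) * a) * Real.sqrt ((n : ℝ) * n)
      = n * a * Real.sqrt ((n : ℝ) / a) := by
    rw [← Real.sqrt_mul (by positivity)]
    rw [show (n : ℝ) * a * (n * n) = (n * a) ^ 2 * (n / a) by field_simp]
    rw [Real.sqrt_mul (by positivity), Real.sqrt_sq (by positivity)]
  rw [hsub]
  have hfin : (n : ℝ) * a * ‖∑ k, c k * z ^ (k : ℕ)‖
      ≤ (n : ℝ) * a * (Real.sqrt ((n : ℝ) / a) * M) := by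
    refine (hle.trans (mul_le_mul_of_nonneg_left hcs hM)).trans (le_of_eq ?_)
    rw [hs]; ring
  exact le_of_mul_le_mul_left hfin (by positivity)

lemma aux_norm (d : ℕ) (c : Fin (2 * d + 1) → ℂ) (w : ℝ) :
    ‖∑ k : Fin (2 * d + 1), c k * Complex.exp (Complex.I * w * (((k : ℕ) : ℂ) - (d : ℂ)))‖
      = ‖∑ k, c k * Complex.exp (w * Complex.I) ^ (k : ℕ)‖ := by
  have h1 : ∑ k : Fin (2 * d + 1), c k * Complex.exp (Complex.I * w * (((k : ℕ) : ℂ) - (d : ℂ)))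
      = (∑ k, c k * Complex.exp (w * Complex.I) ^ (k : ℕ)) *
        Complex.exp (((-(w * d) : ℝ) : ℂ) * Complex.I) := by
    rw [Finset.sum_mul]
    refine Finset.sum_congr rfl fun k _ => ?_
    rw [← Complex.exp_nat_mul, mul_assoc (c k), ← Complex.exp_add]
    congr 2
    push_cast
    ring
  rw [h1, norm_mul, Complex.norm_exp_ofReal_mul_I, mul_one]

lemma aux_one (d n : ℕ) (hn : 2 * d + 1 ≤ n) (c : Fin (2 * d + 1) → ℂ) (M : ℝ)
    (h : ∀ l : Fin n, ‖∑ k : Fin (2 * d + 1), c k * Complex.exp (Complex.I *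
      ((2 * Real.pi * ((l : ℕ) + 1) / n : ℝ) : ℂ) * (((k : ℕ) : ℂ) - (d : ℂ)))‖ ≤ M) (w : ℝ) :
    ‖∑ k : Fin (2 * d + 1), c k * Complex.exp (Complex.I * w * (((k : ℕ) : ℂ) - (d : ℂ)))‖
      ≤ Real.sqrt ((n : ℝ) / (n - 2 * d)) * M := by
  have hω := Complex.isPrimitiveRoot_exp n (by omega)
  rw [aux_norm]
  refine aux_core d n hn _ hω (hω.norm'_eq_one (by omega)) _
    (Complex.norm_exp_ofReal_mul_I w) c M fun l => ?_
  have := h l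
  rw [aux_norm] at this
  convert this using 6
  rw [← Complex.exp_nat_mul]
  congr 1
  push_cast
  ring

/-- Sampling bound for bivariate trigonometric polynomials: the maximum of `|γ|` over
`[0,2π]²` is bounded by `(1-α)⁻¹` times its maximum over the `n × n` grid of equidistant
sampling points, where `α = 2d/n` and `d` is the degree. -/
theorem trig_poly_max_le_sampled_max
    (d : ℕ) (Γ : Matrix (Fin (2 * d + 1)) (Fin (2 * d + 1)) ℂ)
    (γ : ℝ → ℝ → ℂ)
    (hγ : ∀ w1 w2 : ℝ,
      γ w1 w2 = ∑ k1 : Fin (2 * d + 1), ∑ k2 : Fin (2 * d + 1),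
        Γ k1 k2 * Complex.exp (Complex.I * w1 * (((k1:ℕ):ℂ) - (d:ℂ)))
          * Complex.exp (Complex.I * w2 * (((k2:ℕ):ℂ) - (d:ℂ))))
    (n : ℕ) (hn : 2 * d + 1 ≤ n)
    (α : ℝ) (hα : α = (2 * d : ℝ) / n) :
    (⨆ w1 : Set.Icc (0:ℝ) (2 * Real.pi), ⨆ w2 : Set.Icc (0:ℝ) (2 * Real.pi),
        ‖γ w1 w2‖) ≤
      (1 - α)⁻¹ *
        ⨆ l1 : Fin n, ⨆ l2 : Fin n,
          ‖γ (2 * Real.pi * ((l1:ℕ) + 1) / n) (2 * Real.pi * ((l2:ℕ) + 1) / n)‖ := by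
  set G := ⨆ l1 : Fin n, ⨆ l2 : Fin n,
          ‖γ (2 * Real.pi * ((l1:ℕ) + 1) / n) (2 * Real.pi * ((l2:ℕ) + 1) / n)‖ with hG
  have hgrid : ∀ l1 l2 : Fin n,
      ‖γ (2 * Real.pi * ((l1:ℕ) + 1) / n) (2 * Real.pi * ((l2:ℕ) + 1) / n)‖ ≤ G := by
    intro l1 l2
    refine le_trans ?_ (le_ciSup (Set.finite_range _).bddAbove l1)
    exact le_ciSup (f := fun l2 : Fin n =>
      ‖γ (2 * Real.pi * ((l1:ℕ) + 1) / n) (2 * Real.pi * ((l2:ℕ) + 1) / n)‖)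
      (Set.finite_range _).bddAbove l2
  have f1 : ∀ w1 w2 : ℝ, γ w1 w2 = ∑ k1 : Fin (2 * d + 1), (∑ k2 : Fin (2 * d + 1),
        Γ k1 k2 * Complex.exp (Complex.I * w2 * (((k2:ℕ):ℂ) - (d:ℂ))))
          * Complex.exp (Complex.I * w1 * (((k1:ℕ):ℂ) - (d:ℂ))) := by
    intro w1 w2
    rw [hγ]
    refine Finset.sum_congr rfl fun k1 _ => ?_
    rw [Finset.sum_mul]
    exact Finset.sum_congr rfl fun k2 _ => by ring
  have f2 : ∀ w1 w2 : ℝ, γ w1 w2 = ∑ k2 : Fin (2 * d + 1), (∑ k1 : Fin (2 * d + 1),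
        Γ k1 k2 * Complex.exp (Complex.I * w1 * (((k1:ℕ):ℂ) - (d:ℂ))))
          * Complex.exp (Complex.I * w2 * (((k2:ℕ):ℂ) - (d:ℂ))) := by
    intro w1 w2
    rw [hγ, Finset.sum_comm]
    refine Finset.sum_congr rfl fun k2 _ => ?_
    rw [Finset.sum_mul]
  have s1 : ∀ (w1 : ℝ) (l2 : Fin n), ‖γ w1 (2 * Real.pi * ((l2:ℕ) + 1) / n)‖
      ≤ Real.sqrt ((n : ℝ) / (n - 2 * d)) * G := by
    intro w1 l2
    rw [f1]
    refine aux_one d n hn _ G (fun l1 => ?_) w1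
    rw [← f1]
    exact hgrid l1 l2
  have s2 : ∀ w1 w2 : ℝ, ‖γ w1 w2‖ ≤ Real.sqrt ((n : ℝ) / (n - 2 * d)) *
      (Real.sqrt ((n : ℝ) / (n - 2 * d)) * G) := by
    intro w1 w2
    rw [f2]
    refine aux_one d n hn _ _ (fun l2 => ?_) w2
    rw [← f2]
    exact s1 w1 l2
  have hnR : (2 : ℝ) * d + 1 ≤ n := by exact_mod_cast hn
  have hd0 : (0 : ℝ) ≤ d := Nat.cast_nonneg d
  have hn0 : (0 : ℝ) < n := by linarith
  have hsub : (0 : ℝ) < n - 2 * d := by linarith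
  have hC : Real.sqrt ((n : ℝ) / (n - 2 * d)) * Real.sqrt ((n : ℝ) / (n - 2 * d))
      = (1 - α)⁻¹ := by
    rw [Real.mul_self_sqrt (by positivity), hα, one_sub_div hn0.ne', inv_div]
  haveI : Nonempty (Set.Icc (0:ℝ) (2 * Real.pi)) :=
    ⟨⟨0, le_rfl, by positivity⟩⟩
  refine ciSup_le fun w1 => ciSup_le fun w2 => ?_
  rw [← hC, mul_assoc]
  exact s2 w1 w2
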